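/- arXiv:1411.6594 — 3 statements merged into one kernel-verified Lean document; each statement's English description precedes it below -/
import Mathlib

section
/- Let S be a finite set of nonzero integers, n : ℤ → ℕ a multiplicity function, and y a real number. Then the function t ↦ ∏_{w ∈ S} ((1 + y·exp(−w·t))/(1 − exp(−w·t)))^{n(w)} converges as t → −∞ to (−y)^{n⁺}, where n⁺ = ∑_{w ∈ S, w > 0} n(w). -/
open Filter Topology

theorem tendsto_one_add_mul_div_one_sub_nhds_zero (y : ℝ) :
    Tendsto (fun x : ℝ => (1 + y * x) / (1 - x)) (𝓝 0) (𝓝 1) := by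
  have h : ContinuousAt (fun x : ℝ => (1 + y * x) / (1 - x)) 0 :=
    ContinuousAt.div (by fun_prop) (by fun_prop) (by norm_num)
  simpa using h.tendsto

theorem tendsto_one_add_mul_div_one_sub_atTop (y : ℝ) :
    Tendsto (fun x : ℝ => (1 + y * x) / (1 - x)) atTop (𝓝 (-y)) := by
  have h : ContinuousAt (fun x : ℝ => (x + y) / (x - 1)) 0 :=
    ContinuousAt.div (by fun_prop) (by fun_prop) (by norm_num)
  have h' : Tendsto (fun x : ℝ => (x⁻¹ + y) / (x⁻¹ - 1)) atTop (𝓝 (-y)) := by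
    simpa [div_neg, Function.comp_def] using h.tendsto.comp tendsto_inv_atTop_zero
  refine h'.congr' ?_
  filter_upwards [eventually_gt_atTop 0] with x hx
  rw [← mul_div_mul_right (x⁻¹ + y) (x⁻¹ - 1) hx.ne', add_mul, sub_mul,
    inv_mul_cancel₀ hx.ne', one_mul]

/-- The contribution of a single weight `w ≠ 0` tends to `-y` if `w` is positive and to `1` if
`w` is negative. -/
theorem tendsto_weight_factor_atBot {w : ℝ} (hw : w ≠ 0) (y : ℝ) :
    Tendsto (fun t : ℝ => (1 + y * Real.exp (-w * t)) / (1 - Real.exp (-w * t)))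
      atBot (𝓝 (if 0 < w then -y else 1)) := by
  split_ifs with h
  · exact (tendsto_one_add_mul_div_one_sub_atTop y).comp
      (Real.tendsto_exp_atTop.comp (tendsto_id.const_mul_atBot_of_neg (neg_lt_zero.2 h)))
  · have h' : 0 < -w := neg_pos.2 (lt_of_le_of_ne (not_lt.1 h) hw)
    exact (tendsto_one_add_mul_div_one_sub_nhds_zero y).comp
      (Real.tendsto_exp_atBot.comp (tendsto_id.const_mul_atBot h'))

/-- Scalar form of the main limit: for a finite set `S` of nonzero integer
weights with multiplicities `n`, the product
`∏_{w ∈ S} ((1 + y·exp(−w·t))/(1 − exp(−w·t)))^{n(w)}` converges as `t → −∞`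
to `(−y)^{n⁺}` where `n⁺ = ∑_{w ∈ S, w > 0} n(w)`. -/
theorem stmt1 (S : Finset ℤ) (hS : ∀ w ∈ S, w ≠ 0) (n : ℤ → ℕ) (y : ℝ) :
    Tendsto (fun t : ℝ =>
        ∏ w ∈ S,
          ((1 + y * Real.exp (-(w : ℝ) * t)) / (1 - Real.exp (-(w : ℝ) * t))) ^ n w)
      atBot (𝓝 ((-y) ^ (∑ w ∈ S.filter (fun w => 0 < w), n w))) := by
  have h := tendsto_finsetProd S fun w hw =>
    (tendsto_weight_factor_atBot (Int.cast_ne_zero.2 (hS w hw)) y).pow (n w)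
  convert h using 2
  simp [ite_pow, ← Finset.prod_filter, Finset.prod_pow_eq_pow_sum]
end

section
/- Let S be a finite set of nonzero integers and let n, m : ℤ → ℕ. Suppose that for every real θ with 0 < θ < 1 and every real y one has ∏_{w ∈ S} ((θ^w + y)/(θ^w − 1))^{n(w)} = ∏_{w ∈ S} ((θ^w + y)/(θ^w − 1))^{m(w)}, where θ^w denotes the integer (zpow) power of the nonzero real θ. Then n(w) = m(w) for every w ∈ S. -/
open Polynomial in
/-- The multiplicity of the root `a i` in a product of powers of linear factors with pairwise
distinct roots `a j` and nonzero leading coefficients `c j` is the exponent of its factor. -/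
theorem count_roots_prod_linear_pow {ι K : Type*} [Field K] [DecidableEq K]
    (s : Finset ι) (a c : ι → K) (k : ι → ℕ) (ha : Set.InjOn a s) (hc : ∀ i ∈ s, c i ≠ 0)
    {i : ι} (hi : i ∈ s) :
    (∏ j ∈ s, (C (c j) * (X - C (a j))) ^ k j).roots.count (a i) = k i := by
  have hne : ∏ j ∈ s, (C (c j) * (X - C (a j))) ^ k j ≠ 0 :=
    Finset.prod_ne_zero_iff.2 fun j hj =>
      pow_ne_zero _ (mul_ne_zero (C_ne_zero.2 (hc j hj)) (X_sub_C_ne_zero _))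
  rw [roots_prod _ _ hne, Multiset.count_bind]
  change ∑ j ∈ s, Multiset.count (a i) ((C (c j) * (X - C (a j))) ^ k j).roots = k i
  rw [Finset.sum_eq_single_of_mem i hi]
  · rw [roots_pow, roots_C_mul _ (hc i hi), roots_X_sub_C]
    simp
  · intro j hj hji
    have hij : a i ≠ a j := fun e => hji (ha hj hi e.symm)
    rw [roots_pow, roots_C_mul _ (hc j hj), roots_X_sub_C]
    simp [hij]

/-- Section 11: the multiplicities `n(w)` are determined by the function
`Δ(n)(θ, y) = ∏_{w ∈ S} ((θ^w + y)/(θ^w − 1))^{n(w)}` for `0 < θ < 1`: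
if two multiplicity functions give the same `Δ` then they agree on `S`. -/
theorem stmt13 (S : Finset ℤ) (hS : ∀ w ∈ S, w ≠ 0) (n m : ℤ → ℕ)
    (h : ∀ θ : ℝ, 0 < θ → θ < 1 → ∀ y : ℝ,
      ∏ w ∈ S, ((θ ^ w + y) / (θ ^ w - 1)) ^ n w =
        ∏ w ∈ S, ((θ ^ w + y) / (θ ^ w - 1)) ^ m w) :
    ∀ w ∈ S, n w = m w := by
  classical
  intro w hw
  have hinj : Function.Injective fun v : ℤ => (1 / 2 : ℝ) ^ v :=
    zpow_right_injective₀ (by norm_num) (by norm_num)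
  let a : ℤ → ℝ := fun v => -(1 / 2 : ℝ) ^ v
  let c : ℤ → ℝ := fun v => ((1 / 2 : ℝ) ^ v - 1)⁻¹
  have ha : Set.InjOn a S := fun u _ v _ e => hinj (neg_injective e)
  have hc : ∀ v ∈ S, c v ≠ 0 := fun v hv =>
    inv_ne_zero (sub_ne_zero.2 fun e => hS v hv (hinj (by simpa using e)))
  have key : ∏ v ∈ S, (Polynomial.C (c v) * (Polynomial.X - Polynomial.C (a v))) ^ n v =
      ∏ v ∈ S, (Polynomial.C (c v) * (Polynomial.X - Polynomial.C (a v))) ^ m v := by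
    refine Polynomial.funext fun y => ?_
    have hy := h (1 / 2) (by norm_num) (by norm_num) y
    have hv : ∀ v : ℤ, c v * (y - a v) =
        ((1 / 2 : ℝ) ^ v + y) / ((1 / 2 : ℝ) ^ v - 1) := fun v => by
      simp only [a, c, div_eq_mul_inv]
      ring
    simpa only [Polynomial.eval_prod, Polynomial.eval_pow, Polynomial.eval_mul,
      Polynomial.eval_sub, Polynomial.eval_C, Polynomial.eval_X, hv] using hy
  rw [← count_roots_prod_linear_pow S a c n ha hc hw, key,
    count_roots_prod_linear_pow S a c m ha hc hw]
end

section
/- For every real number θ with θ > 0 and θ ≠ 1, and every real number y, setting D(a,b) = ((θ^a + y)·(θ^b + y))/((θ^a − 1)·(θ^b − 1)) for positive integers a, b, one has D(1,4) − D(1,3) + D(2,2) + D(3,4) − 2·D(2,4) = 0. -/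
/-- The relation `Δ(1,4) − Δ(1,3) + Δ(2,2) + Δ(3,4) − 2Δ(2,4) = 0` of
Remark 3 (kontr): for `θ > 0`, `θ ≠ 1` and any real `y`, with
`D a b = ((θ^a + y)(θ^b + y))/((θ^a − 1)(θ^b − 1))`. -/
theorem stmt14 (θ y : ℝ) (hθ : 0 < θ) (hθ1 : θ ≠ 1)
    (D : ℕ → ℕ → ℝ)
    (hD : ∀ a b : ℕ, 0 < a → 0 < b →
      D a b = ((θ ^ a + y) * (θ ^ b + y)) / ((θ ^ a - 1) * (θ ^ b - 1))) :
    D 1 4 - D 1 3 + D 2 2 + D 3 4 - 2 * D 2 4 = 0 := by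
  have h₁ : θ - 1 ≠ 0 := sub_ne_zero.mpr hθ1
  have h₂ : θ + 1 ≠ 0 := by positivity
  have h₃ : θ ^ 2 + θ + 1 ≠ 0 := by positivity
  have h₄ : θ ^ 2 + 1 ≠ 0 := by positivity
  have e₂ : θ ^ 2 - 1 = (θ - 1) * (θ + 1) := by ring
  have e₃ : θ ^ 3 - 1 = (θ - 1) * (θ ^ 2 + θ + 1) := by ring
  have e₄ : θ ^ 4 - 1 = (θ - 1) * (θ + 1) * (θ ^ 2 + 1) := by ring
  rw [hD 1 4 (by norm_num) (by norm_num), hD 1 3 (by norm_num) (by norm_num),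
    hD 2 2 (by norm_num) (by norm_num), hD 3 4 (by norm_num) (by norm_num),
    hD 2 4 (by norm_num) (by norm_num), pow_one, e₂, e₃, e₄]
  field_simp
  ring
end
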